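/- Let A be a regular Hopf coquasigroup over a field k and let φ and φ' be two faithful left integrals on A. Then there exists a scalar λ ∈ k such that φ' = λφ; i.e., the faithful left integral on A is unique up to a scalar. -/

import Mathlib

open TensorProduct

/-- A regular Hopf coquasigroup over a field `k`: a unital associative `k`-algebra `A`
with a (not necessarily coassociative) coproduct `comul : A →ₐ[k] A ⊗[k] A`, a counit
`counit : A →ₐ[k] k`, and a bijective antipode `antipode : A ≃ₗ[k] A` which is
antimultiplicative, anticomultiplicative, and satisfies the quasigroup antipode
identities. -/
structure RegularHopfCoquasigroup (k A : Type*) [Field k] [Ring A] [Algebra k A] where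
  comul : A →ₐ[k] A ⊗[k] A
  counit : A →ₐ[k] k
  antipode : A ≃ₗ[k] A
  /-- `(ε ⊗ id) ∘ Δ = id` -/
  counit_comul_left : ∀ a : A,
    (TensorProduct.lid k A) ((LinearMap.rTensor A counit.toLinearMap) (comul a)) = a
  /-- `(id ⊗ ε) ∘ Δ = id` -/
  counit_comul_right : ∀ a : A,
    (TensorProduct.rid k A) ((LinearMap.lTensor A counit.toLinearMap) (comul a)) = a
  /-- `S(ab) = S(b)S(a)` -/
  antipode_mul : ∀ a b : A, antipode (a * b) = antipode b * antipode a
  /-- `S(1) = 1` -/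
  antipode_one : antipode (1 : A) = 1
  /-- `Δ ∘ S = (S ⊗ S) ∘ flip ∘ Δ` -/
  antipode_comul : ∀ a : A,
    comul (antipode a) =
      (TensorProduct.map antipode.toLinearMap antipode.toLinearMap)
        ((TensorProduct.comm k A A) (comul a))
  /-- `S(a₍₁₎)a₍₂₎₍₁₎ ⊗ a₍₂₎₍₂₎ = 1 ⊗ a` -/
  quasi₁ : ∀ a : A,
    (LinearMap.rTensor A (LinearMap.mul' k A))
      ((TensorProduct.assoc k A A A).symm
        ((LinearMap.rTensor (A ⊗[k] A) antipode.toLinearMap)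
          ((LinearMap.lTensor A comul.toLinearMap) (comul a)))) = (1 : A) ⊗ₜ[k] a
  /-- `a₍₁₎S(a₍₂₎₍₁₎) ⊗ a₍₂₎₍₂₎ = 1 ⊗ a` -/
  quasi₂ : ∀ a : A,
    (LinearMap.rTensor A (LinearMap.mul' k A))
      ((TensorProduct.assoc k A A A).symm
        ((LinearMap.lTensor A (LinearMap.rTensor A antipode.toLinearMap))
          ((LinearMap.lTensor A comul.toLinearMap) (comul a)))) = (1 : A) ⊗ₜ[k] a
  /-- `a₍₁₎₍₁₎ ⊗ S(a₍₁₎₍₂₎)a₍₂₎ = a ⊗ 1` -/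
  quasi₃ : ∀ a : A,
    (LinearMap.lTensor A (LinearMap.mul' k A))
      ((TensorProduct.assoc k A A A)
        ((LinearMap.rTensor A (LinearMap.lTensor A antipode.toLinearMap))
          ((LinearMap.rTensor A comul.toLinearMap) (comul a)))) = a ⊗ₜ[k] (1 : A)
  /-- `a₍₁₎₍₁₎ ⊗ a₍₁₎₍₂₎S(a₍₂₎) = a ⊗ 1` -/
  quasi₄ : ∀ a : A,
    (LinearMap.lTensor A (LinearMap.mul' k A))
      ((TensorProduct.assoc k A A A)
        ((LinearMap.lTensor (A ⊗[k] A) antipode.toLinearMap)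
          ((LinearMap.rTensor A comul.toLinearMap) (comul a)))) = a ⊗ₜ[k] (1 : A)

variable {k A : Type*} [Field k] [Ring A] [Algebra k A]

/-- `(id ⊗ f)` on `A ⊗[k] A`, composed with `A ⊗ k ≅ A`; so `idT f (a ⊗ b) = f b • a`,
i.e. in Sweedler notation `idT f (Δ a) = a₍₁₎ f(a₍₂₎)`. -/
noncomputable def idT (f : A →ₗ[k] k) : A ⊗[k] A →ₗ[k] A :=
  (TensorProduct.rid k A).toLinearMap ∘ₗ LinearMap.lTensor A f

/-- `(f ⊗ id)` on `A ⊗[k] A`, composed with `k ⊗ A ≅ A`; so `Tid f (a ⊗ b) = f a • b`,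
i.e. in Sweedler notation `Tid f (Δ a) = f(a₍₁₎) a₍₂₎`. -/
noncomputable def Tid (f : A →ₗ[k] k) : A ⊗[k] A →ₗ[k] A :=
  (TensorProduct.lid k A).toLinearMap ∘ₗ LinearMap.rTensor A f

/-- A linear functional `f` on `A` is faithful if `f(a·) = 0` implies `a = 0` and
`f(·a) = 0` implies `a = 0`. -/
def Faithful (f : A →ₗ[k] k) : Prop :=
  (∀ a : A, (∀ b : A, f (a * b) = 0) → a = 0) ∧
  (∀ a : A, (∀ b : A, f (b * a) = 0) → a = 0)

/-- A left integral: a nonzero functional `φ` with `a₍₁₎ φ(a₍₂₎) = φ(a)·1`. -/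
def IsLeftIntegral (H : RegularHopfCoquasigroup k A) (φ : A →ₗ[k] k) : Prop :=
  φ ≠ 0 ∧ ∀ a : A, idT φ (H.comul a) = φ a • (1 : A)

/-- A right integral: a nonzero functional `ψ` with `ψ(a₍₁₎) a₍₂₎ = ψ(a)·1`. -/
def IsRightIntegral (H : RegularHopfCoquasigroup k A) (ψ : A →ₗ[k] k) : Prop :=
  ψ ≠ 0 ∧ ∀ a : A, Tid ψ (H.comul a) = ψ a • (1 : A)


@[simp]
theorem idT_tmul (f : A →ₗ[k] k) (a b : A) : idT f (a ⊗ₜ[k] b) = f b • a := by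
  simp [idT]

@[simp]
theorem Tid_tmul (f : A →ₗ[k] k) (a b : A) : Tid f (a ⊗ₜ[k] b) = f a • b := by
  simp [Tid]

theorem apply_idT_eq_apply_Tid (f g : A →ₗ[k] k) (t : A ⊗[k] A) :
    g (idT f t) = f (Tid g t) := by
  induction t with
  | zero => simp
  | add x y hx hy => simp [hx, hy]
  | tmul x y => simp [mul_comm]

theorem idT_mul_tmul_one (f : A →ₗ[k] k) (t : A ⊗[k] A) (x : A) :
    idT f (t * x ⊗ₜ[k] 1) = idT f t * x := by
  induction t with
  | zero => simp
  | add x y hx hy => simp [add_mul, hx, hy]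
  | tmul x y => simp

theorem Tid_mul_one_tmul (f : A →ₗ[k] k) (t : A ⊗[k] A) (x : A) :
    Tid f (t * 1 ⊗ₜ[k] x) = Tid f t * x := by
  induction t with
  | zero => simp
  | add x y hx hy => simp [add_mul, hx, hy]
  | tmul x y => simp

theorem idT_mul_one_tmul (f : A →ₗ[k] k) (t : A ⊗[k] A) (x : A) :
    idT f (t * 1 ⊗ₜ[k] x) = idT (f ∘ₗ LinearMap.mulRight k x) t := by
  induction t with
  | zero => simp
  | add x y hx hy => simp [add_mul, hx, hy]
  | tmul x y => simp

theorem apply_idT_comp_mulLeft (f g : A →ₗ[k] k) (a : A) (t : A ⊗[k] A) :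
    g (idT (f ∘ₗ LinearMap.mulLeft k a) t) = f (a * Tid g t) := by
  rw [apply_idT_eq_apply_Tid]; simp

namespace RegularHopfCoquasigroup

/-- The linear map `u ⊗ v ↦ Δ(v)(S⁻¹(u) ⊗ 1)`. -/
noncomputable def comulSndMul (H : RegularHopfCoquasigroup k A) : A ⊗[k] A →ₗ[k] A ⊗[k] A :=
  TensorProduct.lift (LinearMap.mk₂ k
    (fun u v => H.comul v * H.antipode.symm u ⊗ₜ[k] (1 : A))
    (by intros; simp [TensorProduct.add_tmul, mul_add])
    (by intros; simp [← TensorProduct.smul_tmul'])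
    (by intros; simp [add_mul])
    (by intros; simp))

/-- The linear map `u ⊗ v ↦ Δ(u)(1 ⊗ S(v))`. -/
noncomputable def comulFstMul (H : RegularHopfCoquasigroup k A) : A ⊗[k] A →ₗ[k] A ⊗[k] A :=
  TensorProduct.lift (LinearMap.mk₂ k
    (fun u v => H.comul u * (1 : A) ⊗ₜ[k] H.antipode v)
    (by intros; simp [add_mul])
    (by intros; simp)
    (by intros; simp [TensorProduct.tmul_add, mul_add])
    (by intros; simp))

variable (H : RegularHopfCoquasigroup k A)

@[simp]
theorem comulSndMul_tmul (u v : A) :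
    H.comulSndMul (u ⊗ₜ[k] v) = H.comul v * H.antipode.symm u ⊗ₜ[k] (1 : A) := by
  simp [comulSndMul]

@[simp]
theorem comulFstMul_tmul (u v : A) :
    H.comulFstMul (u ⊗ₜ[k] v) = H.comul u * (1 : A) ⊗ₜ[k] H.antipode v := by
  simp [comulFstMul]

/-- `a₍₂₎₍₁₎S⁻¹(a₍₁₎) ⊗ a₍₂₎₍₂₎ = 1 ⊗ a`. -/
theorem comulSndMul_comul (a : A) : H.comulSndMul (H.comul a) = (1 : A) ⊗ₜ[k] a := by
  have key : ∀ u : A, ∀ z : A ⊗[k] A,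
      LinearMap.rTensor A H.antipode.toLinearMap (z * H.antipode.symm u ⊗ₜ[k] (1 : A)) =
      LinearMap.rTensor A (LinearMap.mul' k A) ((TensorProduct.assoc k A A A).symm
        (LinearMap.lTensor A (LinearMap.rTensor A H.antipode.toLinearMap) (u ⊗ₜ[k] z))) := by
    intro u z
    induction z with
    | zero => simp
    | add x y hx hy => rw [add_mul, map_add, hx, hy]; simp [TensorProduct.tmul_add]
    | tmul x y => simp [H.antipode_mul]
  have gen : ∀ s : A ⊗[k] A,
      LinearMap.rTensor A H.antipode.toLinearMap (H.comulSndMul s) =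
      LinearMap.rTensor A (LinearMap.mul' k A) ((TensorProduct.assoc k A A A).symm
        (LinearMap.lTensor A (LinearMap.rTensor A H.antipode.toLinearMap)
          (LinearMap.lTensor A H.comul.toLinearMap s))) := by
    intro s
    induction s with
    | zero => simp
    | add x y hx hy => simp only [map_add, hx, hy]
    | tmul x y => rw [comulSndMul_tmul, key]; rfl
  apply (LinearEquiv.rTensor A H.antipode).injective
  change LinearMap.rTensor A H.antipode.toLinearMap _ =
    LinearMap.rTensor A H.antipode.toLinearMap _
  rw [gen, H.quasi₂]
  simp [H.antipode_one]

/-- `a₍₁₎₍₁₎ ⊗ a₍₁₎₍₂₎S(a₍₂₎) = a ⊗ 1`. -/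
theorem comulFstMul_comul (a : A) : H.comulFstMul (H.comul a) = a ⊗ₜ[k] (1 : A) := by
  have key : ∀ v : A, ∀ z : A ⊗[k] A, z * (1 : A) ⊗ₜ[k] H.antipode v =
      LinearMap.lTensor A (LinearMap.mul' k A) (TensorProduct.assoc k A A A
        (LinearMap.lTensor (A ⊗[k] A) H.antipode.toLinearMap (z ⊗ₜ[k] v))) := by
    intro v z
    induction z with
    | zero => simp
    | add x y hx hy => rw [add_mul, hx, hy]; simp [TensorProduct.add_tmul]
    | tmul x y => simp
  have gen : ∀ s : A ⊗[k] A, H.comulFstMul s =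
      LinearMap.lTensor A (LinearMap.mul' k A) (TensorProduct.assoc k A A A
        (LinearMap.lTensor (A ⊗[k] A) H.antipode.toLinearMap
          (LinearMap.rTensor A H.comul.toLinearMap s))) := by
    intro s
    induction s with
    | zero => simp
    | add x y hx hy => simp only [map_add, hx, hy]
    | tmul x y => rw [comulFstMul_tmul, key]; rfl
  rw [gen, H.quasi₄]

end RegularHopfCoquasigroup

variable {H : RegularHopfCoquasigroup k A} {φ ψ : A →ₗ[k] k}

theorem IsLeftIntegral.comp_antipode (hφ : IsLeftIntegral H φ) :
    IsRightIntegral H (φ ∘ₗ H.antipode.toLinearMap) := by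
  refine ⟨fun h => hφ.1 ?_, fun a => ?_⟩
  · ext x
    simpa using LinearMap.congr_fun h (H.antipode.symm x)
  · have gen : ∀ t : A ⊗[k] A,
        idT φ (TensorProduct.map H.antipode.toLinearMap H.antipode.toLinearMap
          (TensorProduct.comm k A A t)) =
        H.antipode (Tid (φ ∘ₗ H.antipode.toLinearMap) t) := by
      intro t
      induction t with
      | zero => simp
      | add x y hx hy => simp only [map_add, hx, hy]
      | tmul x y => simp
    apply H.antipode.injective
    rw [← gen, ← H.antipode_comul, hφ.2]
    simp [H.antipode_one]

/-- `ψ(a₍₁₎t₁)φ(a₍₂₎t₂)` has the form `φ(ad)` with `d` not depending on `a`. -/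
theorem IsLeftIntegral.exists_apply_comul_mul (hφ : IsLeftIntegral H φ) (ψ : A →ₗ[k] k)
    (t : A ⊗[k] A) : ∃ d : A, ∀ a : A, ψ (idT φ (H.comul a * t)) = φ (a * d) := by
  induction t with
  | zero => exact ⟨0, by simp⟩
  | add x y hx hy =>
    obtain ⟨d, hd⟩ := hx
    obtain ⟨e, he⟩ := hy
    exact ⟨d + e, fun a => by simp [mul_add, hd, he]⟩
  | tmul x y =>
    have gen : ∀ s : A ⊗[k] A, ∃ d : A, ∀ a : A,
        ψ (idT φ (H.comul a * (H.comulSndMul s * x ⊗ₜ[k] 1))) = φ (a * d) := by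
      intro s
      induction s with
      | zero => exact ⟨0, by simp⟩
      | add x y hx hy =>
        obtain ⟨d, hd⟩ := hx
        obtain ⟨e, he⟩ := hy
        exact ⟨d + e, fun a => by simp [mul_add, add_mul, hd, he]⟩
      | tmul u v =>
        refine ⟨ψ (H.antipode.symm u * x) • v, fun a => ?_⟩
        rw [H.comulSndMul_tmul, ← mul_assoc, ← mul_assoc, ← map_mul, idT_mul_tmul_one,
          idT_mul_tmul_one, hφ.2]
        simp [mul_comm]
    simpa [H.comulSndMul_comul] using gen (H.comul y)

/-- `ψ(a₍₁₎r)φ(a₍₂₎)` has the form `ψ(ap)` with `p` not depending on `a`. -/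
theorem IsRightIntegral.exists_apply_comul_mul (hψ : IsRightIntegral H ψ) (φ : A →ₗ[k] k)
    (r : A) : ∃ p : A, ∀ a : A, φ (Tid ψ (H.comul a * r ⊗ₜ[k] 1)) = ψ (a * p) := by
  have gen : ∀ s : A ⊗[k] A, ∃ p : A, ∀ a : A,
      φ (Tid ψ (H.comul a * H.comulFstMul s)) = ψ (a * p) := by
    intro s
    induction s with
    | zero => exact ⟨0, by simp⟩
    | add x y hx hy =>
      obtain ⟨d, hd⟩ := hx
      obtain ⟨e, he⟩ := hy
      exact ⟨d + e, fun a => by simp [mul_add, hd, he]⟩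
    | tmul u v =>
      refine ⟨φ (H.antipode v) • u, fun a => ?_⟩
      rw [H.comulFstMul_tmul, ← mul_assoc, ← map_mul, Tid_mul_one_tmul, hψ.2]
      simp [mul_comm]
  simpa [H.comulFstMul_comul] using gen (H.comul r)

theorem exists_apply_eq_one {f : A →ₗ[k] k} (hf : f ≠ 0) : ∃ x : A, f x = 1 := by
  obtain ⟨x, hx⟩ := DFunLike.ne_iff.mp hf
  exact ⟨(f x)⁻¹ • x, by simpa using inv_mul_cancel₀ hx⟩

theorem IsLeftIntegral.exists_eq_right_mul (hφ : IsLeftIntegral H φ)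
    (hψ : IsRightIntegral H ψ) : ∃ p : A, ∀ a : A, φ a = ψ (a * p) := by
  obtain ⟨r, hr⟩ := exists_apply_eq_one hψ.1
  obtain ⟨p, hp⟩ := hψ.exists_apply_comul_mul φ r
  refine ⟨p, fun a => ?_⟩
  rw [← hp, ← apply_idT_eq_apply_Tid, idT_mul_tmul_one, hφ.2]
  simp [hr]

theorem IsRightIntegral.exists_eq_left_mul (hψ : IsRightIntegral H ψ)
    (hφ : IsLeftIntegral H φ) (p : A) : ∃ d : A, ∀ a : A, ψ (a * p) = φ (a * d) := by
  obtain ⟨q, hq⟩ := exists_apply_eq_one hφ.1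
  obtain ⟨d, hd⟩ := hφ.exists_apply_comul_mul ψ (H.comul p * 1 ⊗ₜ[k] q)
  refine ⟨d, fun a => ?_⟩
  rw [← hd, ← mul_assoc, ← map_mul, apply_idT_eq_apply_Tid, Tid_mul_one_tmul, hψ.2]
  simp [hq]

/-- `φ(ad₍₂₎)d₍₁₎ = S(a₍₁₎φ(a₍₂₎d))`. -/
theorem IsLeftIntegral.idT_comp_mulLeft (hφ : IsLeftIntegral H φ) (a d : A) :
    idT (φ ∘ₗ LinearMap.mulLeft k a) (H.comul d) =
      H.antipode (idT φ (H.comul a * 1 ⊗ₜ[k] d)) := by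
  have gen : ∀ s : A ⊗[k] A, idT (φ ∘ₗ LinearMap.mulLeft k a) s =
      H.antipode (idT φ (H.comul a * H.comulSndMul s)) := by
    intro s
    induction s with
    | zero => simp
    | add x y hx hy => simp only [map_add, mul_add, hx, hy]
    | tmul u v =>
      rw [H.comulSndMul_tmul, ← mul_assoc, ← map_mul, idT_mul_tmul_one, hφ.2]
      simp
  rw [gen, H.comulSndMul_comul]

/-- faithful left integrals are unique up to a scalar. -/
theorem stmt_7 (k A : Type*) [Field k] [Ring A] [Algebra k A]
    (H : RegularHopfCoquasigroup k A) (φ φ' : A →ₗ[k] k)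
    (hφ : IsLeftIntegral H φ) (hfφ : Faithful φ)
    (hφ' : IsLeftIntegral H φ') (hfφ' : Faithful φ') :
    ∃ lam : k, φ' = lam • φ := by
  obtain ⟨p, hp⟩ := hφ'.exists_eq_right_mul hφ.comp_antipode
  obtain ⟨d, hd⟩ := hφ.comp_antipode.exists_eq_left_mul hφ p
  have hmul : φ ∘ₗ LinearMap.mulRight k d = φ' := by
    ext a
    simp [hp, hd]
  have hinv (a : A) :
      idT (φ ∘ₗ LinearMap.mulLeft k a) (H.comul d) = φ (a * d) • (1 : A) := by
    rw [hφ.idT_comp_mulLeft, idT_mul_one_tmul, hmul, hφ'.2, ← hmul]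
    simp [H.antipode_one]
  have hTid (g : A →ₗ[k] k) : Tid g (H.comul d) = g 1 • d := by
    rw [← sub_eq_zero]
    refine hfφ.2 _ fun a => ?_
    rw [mul_sub, map_sub, ← apply_idT_comp_mulLeft, hinv]
    simp [mul_comm]
  refine ⟨H.counit d, ?_⟩
  ext a
  have hg := apply_idT_eq_apply_Tid H.counit.toLinearMap (φ ∘ₗ LinearMap.mulLeft k a)
    (H.comul d)
  rw [hTid, show idT H.counit.toLinearMap (H.comul d) = d from H.counit_comul_right d] at hg
  simpa [← hmul, mul_comm] using hg
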